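/- arXiv:1708.06302 — 8 statements merged into one kernel-verified Lean document; each statement's English description precedes it below -/
import Mathlib

section
/- Matrix representation of a Vecchia approximation (Proposition 1): Let Σ be an n×n real symmetric positive definite matrix and for each i ∈ {1,…,n} let g(i) ⊆ {1,…,i−1}. Define the row vector b_i := Σ_{i,g(i)}·(Σ_{g(i),g(i)})⁻¹ and the scalar d_i := Σ_{i,i} − b_i·Σ_{g(i),i}. Then each d_i > 0, and the n×n matrix U defined by U_{i,i} = d_i^{−1/2}, U_{j,i} = −(b_i)_j·d_i^{−1/2} for j ∈ g(i), and U_{j,i} = 0 otherwise, is upper triangular and invertible, and for every x ∈ ℝⁿ the product of conditional Gaussian densities equals a joint Gaussian density with precision matrix U·Uᵀ: ∏_{i=1}^{n} (2π d_i)^{−1/2} exp(−(x_i − Σ_{j∈g(i)} (b_i)_j x_j)² / (2 d_i)) = (2π)^{−n/2} det(U) · exp(−½ xᵀ (U·Uᵀ) x). -/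
open Matrix Real

/-- Row-vector form of the normal equations: the coefficients `c = r (A_{s,s})⁻¹`, extended by zero
off `s`, satisfy `c A = r` on `s`. -/
theorem sum_regression_coeff_mul {ι R : Type*} [Fintype ι] [DecidableEq ι] [CommRing R]
    (A : Matrix ι ι R) (s : Finset ι) (r c : ι → R)
    (hA : IsUnit (A.submatrix (fun t : {x // x ∈ s} => t.1) (fun t : {x // x ∈ s} => t.1)).det)
    (hc : ∀ j, c j = if h : j ∈ s then
        ∑ a ∈ s.attach, r a.1 *
          ((A.submatrix (fun t : {x // x ∈ s} => t.1) (fun t : {x // x ∈ s} => t.1))⁻¹ a ⟨j, h⟩)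
      else 0)
    {l : ι} (hl : l ∈ s) : ∑ k, c k * A k l = r l := by
  set B := A.submatrix (fun t : {x // x ∈ s} => t.1) (fun t : {x // x ∈ s} => t.1) with hB
  have hsum : ∑ k, c k * A k l = ∑ k : {x // x ∈ s}, c k * A k l := by
    rw [Finset.sum_coe_sort s (fun k => c k * A k l)]
    refine (Finset.sum_subset (Finset.subset_univ s) fun k _ hk => ?_).symm
    rw [hc k, dif_neg hk, zero_mul]
  have hcB : (fun k : {x // x ∈ s} => c k) = (fun a : {x // x ∈ s} => r a) ᵥ* B⁻¹ := by
    funext k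
    rw [hc k, dif_pos k.2]
    rfl
  have hrB : (fun k : {x // x ∈ s} => c k) ᵥ* B = fun a : {x // x ∈ s} => r a := by
    rw [hcB, vecMul_vecMul, nonsing_inv_mul _ hA, vecMul_one]
  rw [hsum]
  exact congrFun hrB ⟨l, hl⟩

/-- The residual variance of regressing coordinate `i` on coordinates `s ∌ i` is positive. -/
theorem Matrix.PosDef.residual_variance_pos {ι : Type*} [Fintype ι] [DecidableEq ι]
    {A : Matrix ι ι ℝ} (hA : A.PosDef) {i : ι} {s : Finset ι} (hi : i ∉ s) {c : ι → ℝ}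
    (hc0 : ∀ j ∉ s, c j = 0) (hc : ∀ l ∈ s, ∑ k, c k * A k l = A i l) :
    0 < A i i - ∑ k, c k * A k i := by
  set v : ι → ℝ := Pi.single i 1 - c with hv
  have hvi : v i = 1 := by simp [hv, hc0 i hi]
  have hne : v ≠ 0 := fun h => by simp [h] at hvi
  have hpos : 0 < v ⬝ᵥ (A *ᵥ v) := by simpa using hA.dotProduct_mulVec_pos hne
  have hvA : ∀ l, (v ᵥ* A) l = A i l - ∑ k, c k * A k l := fun l => by
    simp [hv, vecMul, dotProduct, sub_mul, Pi.single_apply]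
  have hres : (v ᵥ* A) ⬝ᵥ v = A i i - ∑ k, c k * A k i := by
    rw [dotProduct, Finset.sum_eq_single i]
    · rw [hvA, hvi, mul_one]
    · intro l _ hl
      by_cases hls : l ∈ s
      · rw [hvA, hc l hls, sub_self, zero_mul]
      · simp [hv, hl, hc0 l hls]
    · simp
  rwa [dotProduct_mulVec, hres] at hpos

theorem dotProduct_mul_transpose_mulVec_self {m n R : Type*} [Fintype m] [Fintype n]
    [CommSemiring R] (U : Matrix m n R) (x : m → R) :
    x ⬝ᵥ ((U * Uᵀ) *ᵥ x) = ∑ i, (x ᵥ* U) i ^ 2 := by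
  rw [← mulVec_mulVec, dotProduct_mulVec, mulVec_transpose, dotProduct]
  simp only [sq]

/-- Matrix representation of a Vecchia approximation (Proposition 1). -/
theorem stmt_3 (n : ℕ) (hn : 0 < n) (S : Matrix (Fin n) (Fin n) ℝ) (hS : S.PosDef)
    (g : Fin n → Finset (Fin n)) (hg : ∀ i : Fin n, ∀ j ∈ g i, j < i)
    (b : Fin n → Fin n → ℝ)
    (hb : ∀ i j : Fin n, b i j = if h : j ∈ g i then
        ∑ a ∈ (g i).attach,
          S i a.1 *
            ((S.submatrix (fun t : {x // x ∈ g i} => t.1) (fun t : {x // x ∈ g i} => t.1))⁻¹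
              a ⟨j, h⟩)
      else 0)
    (d : Fin n → ℝ)
    (hd : ∀ i : Fin n, d i = S i i - ∑ j : Fin n, b i j * S j i)
    (U : Matrix (Fin n) (Fin n) ℝ)
    (hU : ∀ j i : Fin n, U j i =
      if j = i then (d i) ^ (-(1/2) : ℝ)
      else if j ∈ g i then -(b i j) * (d i) ^ (-(1/2) : ℝ)
      else 0) :
    (∀ i : Fin n, 0 < d i) ∧
    (∀ j i : Fin n, i < j → U j i = 0) ∧
    IsUnit U.det ∧
    (∀ x : Fin n → ℝ,
      ∏ i : Fin n, ((2 * π * d i) ^ (-(1/2) : ℝ) *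
          Real.exp (-(x i - ∑ j ∈ g i, b i j * x j) ^ 2 / (2 * d i))) =
        (2 * π) ^ (-(n : ℝ) / 2) * U.det *
          Real.exp (-(1/2) * (x ⬝ᵥ ((U * Uᵀ) *ᵥ x)))) := by
  have hgi : ∀ i, i ∉ g i := fun i h => lt_irrefl i (hg i i h)
  have hd_pos : ∀ i, 0 < d i := fun i => by
    rw [hd i]
    refine hS.residual_variance_pos (hgi i) (fun j hj => by rw [hb, dif_neg hj]) fun l hl => ?_
    exact sum_regression_coeff_mul S (g i) (S i) (b i)
      (hS.submatrix Subtype.val_injective).det_pos.ne'.isUnit (hb i) hl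
  have hUtri : ∀ j i : Fin n, i < j → U j i = 0 := fun j i hij => by
    rw [hU, if_neg hij.ne', if_neg fun h => (hg i j h).not_gt hij]
  have hdet : U.det = ∏ i, d i ^ (-(1 / 2) : ℝ) := by
    rw [det_of_isUpperTriangular fun j i hij => hUtri j i hij]
    exact Finset.prod_congr rfl fun i _ => by rw [hU, if_pos rfl]
  have hcol : ∀ (x : Fin n → ℝ) (i : Fin n),
      (x ᵥ* U) i = d i ^ (-(1 / 2) : ℝ) * (x i - ∑ j ∈ g i, b i j * x j) := fun x i => by
    have hterm : ∀ j, x j * U j i = (if j = i then d i ^ (-(1 / 2) : ℝ) * x i else 0) -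
        if j ∈ g i then d i ^ (-(1 / 2) : ℝ) * (b i j * x j) else 0 := fun j => by
      rw [hU]
      by_cases hji : j = i
      · subst hji
        simp [hgi, mul_comm]
      · by_cases hjg : j ∈ g i
        · simp only [hji, hjg, if_true, if_false]
          ring
        · simp [hji, hjg]
    simp only [vecMul, dotProduct, hterm, Finset.sum_sub_distrib, Finset.sum_ite_eq',
      Finset.sum_ite_mem, Finset.univ_inter, Finset.mem_univ, if_true, mul_sub, Finset.mul_sum]
  have hsq : ∀ i, (d i ^ (-(1 / 2) : ℝ)) ^ 2 = (d i)⁻¹ := fun i => by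
    rw [← rpow_natCast, ← rpow_mul (hd_pos i).le, ← rpow_neg_one]
    norm_num
  have hconst : ∏ _i : Fin n, (2 * π) ^ (-(1 / 2) : ℝ) = (2 * π) ^ (-(n : ℝ) / 2) := by
    rw [Finset.prod_const, Finset.card_univ, Fintype.card_fin, ← rpow_natCast,
      ← rpow_mul (by positivity)]
    congr 1
    ring
  refine ⟨hd_pos, hUtri, ?_, fun x => ?_⟩
  · rw [hdet]
    exact (Finset.prod_pos fun i _ => rpow_pos_of_pos (hd_pos i) _).ne'.isUnit
  · rw [Finset.prod_mul_distrib, ← exp_sum, dotProduct_mul_transpose_mulVec_self, hdet, ← hconst,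
      ← Finset.prod_mul_distrib, Finset.mul_sum]
    congr 2
    · exact funext fun i => mul_rpow two_pi_pos.le (hd_pos i).le
    · refine Finset.sum_congr rfl fun i _ => ?_
      have hdi := (hd_pos i).ne'
      rw [hcol, mul_pow, hsq]
      field_simp
end

section
/- Integrated Vecchia likelihood formula (Proposition 2): Let U be an invertible n×n real matrix, let {1,…,n} be partitioned into disjoint sets Y (of size n_y) and Z (of size n_z), and let U_Y (n_y×n) and U_Z (n_z×n) be the submatrices of U consisting of the rows indexed by Y and Z respectively. Then W := U_Y·U_Yᵀ is symmetric positive definite, and with V := rchol(W) and, for z ∈ ℝ^{n_z}, z̃ := U_Zᵀ·z ∈ ℝⁿ and x(y,z) ∈ ℝⁿ the vector whose Y-coordinates are y and whose Z-coordinates are z, the marginal density satisfies, for every z ∈ ℝ^{n_z}: −2·log( ∫_{ℝ^{n_y}} (2π)^{−n/2} |det U| · exp(−½ x(y,z)ᵀ (U·Uᵀ) x(y,z)) dy ) = −log det(U·Uᵀ) + 2·Σ_{i=1}^{n_y} log V_{i,i} + z̃ᵀz̃ − ‖V⁻¹·U_Y·z̃‖² + n_z·log(2π). -/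
open Matrix Real MeasureTheory

lemma integral_exp_neg_half_dotProduct_self {ι : Type*} [Fintype ι] :
    ∫ y : ι → ℝ, Real.exp (-(1 / 2) * (y ⬝ᵥ y)) = √(2 * π) ^ Fintype.card ι := by
  have hprod (y : ι → ℝ) :
      Real.exp (-(1 / 2) * (y ⬝ᵥ y)) = ∏ i, Real.exp (-(1 / 2) * y i ^ 2) := by
    rw [← Real.exp_sum, dotProduct, Finset.mul_sum]
    simp only [sq]
  simp_rw [hprod]
  rw [integral_fintype_prod_volume_eq_pow (fun x : ℝ => Real.exp (-(1 / 2) * x ^ 2)),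
    integral_gaussian]
  congr 2
  ring

lemma integral_comp_mulVec {ι E : Type*} [Fintype ι] [DecidableEq ι]
    [NormedAddCommGroup E] [NormedSpace ℝ E] {M : Matrix ι ι ℝ} (hM : M.det ≠ 0)
    (f : (ι → ℝ) → E) :
    ∫ y : ι → ℝ, f (M *ᵥ y) = |M.det|⁻¹ • ∫ y, f y := by
  have hemb : MeasurableEmbedding (toLin' M) := by
    refine (LinearMap.continuous_on_pi _).measurableEmbedding ?_
    exact mulVec_injective_of_isUnit ((isUnit_iff_isUnit_det M).2 hM.isUnit)
  have h := hemb.integral_map (μ := volume) f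
  rw [Real.map_matrix_volume_pi_eq_smul_volume_pi hM, integral_smul_measure,
    ENNReal.toReal_ofReal (abs_nonneg _), abs_inv] at h
  simpa using h.symm

/-- Integral of a Gaussian composed with an invertible affine map. -/
lemma integral_exp_neg_half_mulVec_add {ι : Type*} [Fintype ι] [DecidableEq ι]
    {M : Matrix ι ι ℝ} (hM : M.det ≠ 0) (c : ι → ℝ) :
    ∫ y : ι → ℝ, Real.exp (-(1 / 2) * ((M *ᵥ y + c) ⬝ᵥ (M *ᵥ y + c))) =
      |M.det|⁻¹ * √(2 * π) ^ Fintype.card ι := by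
  rw [integral_comp_mulVec hM (fun y => Real.exp (-(1 / 2) * ((y + c) ⬝ᵥ (y + c)))),
    integral_add_right_eq_self (fun y : ι → ℝ => Real.exp (-(1 / 2) * (y ⬝ᵥ y))),
    integral_exp_neg_half_dotProduct_self, smul_eq_mul]

lemma dotProduct_mul_transpose_mulVec {m n : Type*} [Fintype m] [Fintype n]
    (A : Matrix m n ℝ) (x : m → ℝ) :
    x ⬝ᵥ ((A * Aᵀ) *ᵥ x) = (Aᵀ *ᵥ x) ⬝ᵥ (Aᵀ *ᵥ x) := by
  rw [← mulVec_mulVec, dotProduct_mulVec, ← mulVec_transpose]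

/-- Completing the square in `‖Aᵀ y + w‖²`, given a factorization `A Aᵀ = V Vᵀ`. -/
lemma dotProduct_self_transpose_mulVec_add {m n : Type*} [Fintype m] [Fintype n] [DecidableEq m]
    (A : Matrix m n ℝ) {V : Matrix m m ℝ} (hV : IsUnit V.det) (hA : V * Vᵀ = A * Aᵀ)
    (y : m → ℝ) (w : n → ℝ) :
    (Aᵀ *ᵥ y + w) ⬝ᵥ (Aᵀ *ᵥ y + w) =
      (Vᵀ *ᵥ y + V⁻¹ *ᵥ (A *ᵥ w)) ⬝ᵥ (Vᵀ *ᵥ y + V⁻¹ *ᵥ (A *ᵥ w)) +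
        (w ⬝ᵥ w - (V⁻¹ *ᵥ (A *ᵥ w)) ⬝ᵥ (V⁻¹ *ᵥ (A *ᵥ w))) := by
  have hquad : (Aᵀ *ᵥ y) ⬝ᵥ (Aᵀ *ᵥ y) = (Vᵀ *ᵥ y) ⬝ᵥ (Vᵀ *ᵥ y) := by
    rw [← dotProduct_mul_transpose_mulVec, ← hA, dotProduct_mul_transpose_mulVec]
  have hcross : (Aᵀ *ᵥ y) ⬝ᵥ w = (Vᵀ *ᵥ y) ⬝ᵥ (V⁻¹ *ᵥ (A *ᵥ w)) := by
    rw [mulVec_transpose, mulVec_transpose, ← dotProduct_mulVec, ← dotProduct_mulVec,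
      mulVec_mulVec, mul_nonsing_inv V hV, one_mulVec]
  simp only [add_dotProduct, dotProduct_add, hquad, hcross, dotProduct_comm w,
    dotProduct_comm (V⁻¹ *ᵥ (A *ᵥ w)) (Vᵀ *ᵥ y)]
  ring

/-- Integrated Vecchia likelihood formula (Proposition 2). The partition of the index
set `{1,…,n}` into `Y` (size `ny`) and `Z` (size `nz`) is encoded by the equivalence
`e : Fin ny ⊕ Fin nz ≃ Fin (ny + nz)`; `UY` and `UZ` are the rows of `U` indexed by `Y`
and `Z`. `V` ranges over all matrices satisfying the defining property of
`rchol W` (upper triangular, strictly positive diagonal, `V * Vᵀ = W`). -/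
theorem stmt_4 (ny nz : ℕ) (hny : 0 < ny) (hnz : 0 < nz)
    (U : Matrix (Fin (ny + nz)) (Fin (ny + nz)) ℝ) (hUinv : IsUnit U.det)
    (e : Fin ny ⊕ Fin nz ≃ Fin (ny + nz))
    (UY : Matrix (Fin ny) (Fin (ny + nz)) ℝ)
    (hUY : ∀ (i : Fin ny) (k : Fin (ny + nz)), UY i k = U (e (Sum.inl i)) k)
    (UZ : Matrix (Fin nz) (Fin (ny + nz)) ℝ)
    (hUZ : ∀ (i : Fin nz) (k : Fin (ny + nz)), UZ i k = U (e (Sum.inr i)) k)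
    (W : Matrix (Fin ny) (Fin ny) ℝ) (hW : W = UY * UYᵀ) :
    W.PosDef ∧
    ∀ V : Matrix (Fin ny) (Fin ny) ℝ,
      (∀ i j : Fin ny, j < i → V i j = 0) → (∀ i : Fin ny, 0 < V i i) → V * Vᵀ = W →
      ∀ z : Fin nz → ℝ,
        -2 * Real.log (∫ y : Fin ny → ℝ,
            (2 * π) ^ (-(((ny + nz : ℕ)) : ℝ) / 2) * |U.det| *
              Real.exp (-(1/2) *
                ((fun k => Sum.elim y z (e.symm k)) ⬝ᵥ
                  ((U * Uᵀ) *ᵥ (fun k => Sum.elim y z (e.symm k)))))) =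
          -Real.log (U * Uᵀ).det + 2 * ∑ i : Fin ny, Real.log (V i i) +
            (UZᵀ *ᵥ z) ⬝ᵥ (UZᵀ *ᵥ z) -
            (V⁻¹ *ᵥ (UY *ᵥ (UZᵀ *ᵥ z))) ⬝ᵥ (V⁻¹ *ᵥ (UY *ᵥ (UZᵀ *ᵥ z))) +
            (nz : ℝ) * Real.log (2 * π) := by
  have hUYe : UY = U.submatrix (e ∘ Sum.inl) id := by
    ext i k
    exact hUY i k
  constructor
  · rw [hW, ← conjTranspose_eq_transpose_of_trivial]
    refine PosDef.mul_conjTranspose_self UY (vecMul_injective_iff.2 ?_)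
    have hrows : LinearIndependent ℝ U.row :=
      linearIndependent_rows_iff_isUnit.2 ((isUnit_iff_isUnit_det U).2 hUinv)
    rw [hUYe]
    exact hrows.comp _ (e.injective.comp Sum.inl_injective)
  intro V hVtri hVpos hVW z
  have hdet : V.det = ∏ i, V i i := det_of_isUpperTriangular fun i j hij => hVtri i j hij
  have hdet_pos : 0 < V.det := hdet ▸ Finset.prod_pos fun i _ => hVpos i
  have hlogdet : Real.log V.det = ∑ i, Real.log (V i i) := by
    rw [hdet, Real.log_prod fun i _ => (hVpos i).ne']
  have hsplit (y : Fin ny → ℝ) :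
      (Uᵀ *ᵥ fun k => Sum.elim y z (e.symm k)) = UYᵀ *ᵥ y + UZᵀ *ᵥ z := by
    ext k
    simp [mulVec, dotProduct, ← e.sum_comp, hUY, hUZ]
  set w := UZᵀ *ᵥ z with hw
  set q := V⁻¹ *ᵥ (UY *ᵥ w) with hq
  have hU0 : 0 < |U.det| := abs_pos.2 hUinv.ne_zero
  have hpi : 0 < 2 * π := by positivity
  have hintegrand (y : Fin ny → ℝ) :
      Real.exp (-(1/2) * ((fun k => Sum.elim y z (e.symm k)) ⬝ᵥ
        ((U * Uᵀ) *ᵥ (fun k => Sum.elim y z (e.symm k))))) =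
      Real.exp (-(1/2) * ((Vᵀ *ᵥ y + q) ⬝ᵥ (Vᵀ *ᵥ y + q))) *
        Real.exp (-(1/2) * (w ⬝ᵥ w - q ⬝ᵥ q)) := by
    rw [dotProduct_mul_transpose_mulVec, hsplit, dotProduct_self_transpose_mulVec_add UY
      hdet_pos.ne'.isUnit (hVW.trans hW), ← Real.exp_add, mul_add]
  simp_rw [hintegrand]
  rw [integral_const_mul, integral_mul_const, integral_exp_neg_half_mulVec_add
    (by rw [det_transpose]; exact hdet_pos.ne'), det_transpose, abs_of_pos hdet_pos,
    Fintype.card_fin, Real.log_mul (by positivity) (by positivity),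
    Real.log_mul (by positivity) (by positivity), Real.log_mul (by positivity) (by positivity),
    Real.log_mul (by positivity) (by positivity), Real.log_exp, Real.log_inv, Real.log_pow,
    Real.log_sqrt hpi.le, Real.log_rpow hpi, Real.log_abs, det_mul, det_transpose,
    Real.log_mul hUinv.ne_zero hUinv.ne_zero, hlogdet]
  push_cast
  ring
end

section
/- Fill-in of the reverse Cholesky factor (Proposition 3, part 3, matrix form): Let W be an n×n real symmetric positive definite matrix and V := rchol(W) its reverse Cholesky factor. Define the undirected graph G on vertex set {1,…,n} with an edge between a and b whenever a ≠ b and W_{a,b} ≠ 0. For indices j < i, if there is no walk in G from j to i all of whose intermediate vertices are strictly greater than i, then V_{j,i} = 0. -/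
open Matrix

/-- Walks from `j` to `k` and from `i` to `k` with intermediate vertices above `k` glue, at `k > i`,
to a walk from `j` to `i` with intermediate vertices above `i`. -/
theorem exists_walk_glue {α : Type*} [Preorder α] {R : α → α → Prop}
    (hR : ∀ a b, R a b → R b a) {j i k : α} (hik : i < k)
    (hj : ∃ (m : ℕ) (p : ℕ → α), p 0 = j ∧ p m = k ∧
      (∀ t, t < m → R (p t) (p (t + 1))) ∧ (∀ t, 0 < t → t < m → k < p t))
    (hi : ∃ (m : ℕ) (p : ℕ → α), p 0 = i ∧ p m = k ∧
      (∀ t, t < m → R (p t) (p (t + 1))) ∧ (∀ t, 0 < t → t < m → k < p t)) :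
    ∃ (m : ℕ) (p : ℕ → α), p 0 = j ∧ p m = i ∧
      (∀ t, t < m → R (p t) (p (t + 1))) ∧ (∀ t, 0 < t → t < m → i < p t) := by
  obtain ⟨m, p, hp0, hpm, hpR, hpk⟩ := hj
  obtain ⟨l, q, hq0, hql, hqR, hqk⟩ := hi
  refine ⟨m + l, fun t => if t ≤ m then p t else q (m + l - t), by simpa using hp0, ?_, ?_, ?_⟩
  · by_cases hl : l = 0
    · subst hl
      simp [hpm, ← hql, hq0]
    · have h : ¬ m + l ≤ m := by omega
      simp [hl, hq0]
  · intro t ht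
    rcases lt_trichotomy t m with h | h | h
    · simpa [h.le, Nat.succ_le_of_lt h] using hpR t h
    · subst h
      have h1 := hR _ _ (hqR (l - 1) (by omega))
      have h2 : l - 1 + 1 = l := by omega
      have h3 : t + l - (t + 1) = l - 1 := by omega
      rw [h2, hql, ← hpm] at h1
      simpa [h3] using h1
    · have h1 := hR _ _ (hqR (m + l - (t + 1)) (by omega))
      have h2 : m + l - (t + 1) + 1 = m + l - t := by omega
      rw [h2] at h1
      simpa [h.not_ge, show ¬ t + 1 ≤ m by omega] using h1
  · intro t h0 ht
    rcases lt_trichotomy t m with h | h | h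
    · simpa [h.le] using hik.trans (hpk t h0 h)
    · simpa [h, hpm] using hik
    · simpa [h.not_ge] using hik.trans (hqk (m + l - t) (by omega) (by omega))

/-- A nonzero entry of an upper-triangular factor `V` of `V * Vᵀ` is witnessed by a walk in the
graph of `V * Vᵀ` through later vertices. -/
theorem exists_walk_of_upperTriangular_ne_zero {n : ℕ} {V : Matrix (Fin n) (Fin n) ℝ}
    (hV : ∀ a b : Fin n, b < a → V a b = 0) (hd : ∀ a : Fin n, 0 < V a a) (i : Fin n) :
    ∀ j : Fin n, j < i → V j i ≠ 0 → ∃ (m : ℕ) (p : ℕ → Fin n), p 0 = j ∧ p m = i ∧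
      (∀ t, t < m → (p t ≠ p (t + 1) ∧ (V * Vᵀ) (p t) (p (t + 1)) ≠ 0)) ∧
      (∀ t, 0 < t → t < m → i < p t) := by
  induction i using WellFoundedGT.induction with
  | ind i ih =>
    intro j hji hne
    by_cases hW : (V * Vᵀ) j i = 0
    · obtain ⟨k, hki, hk⟩ : ∃ k, k ≠ i ∧ V j k * V i k ≠ 0 := by
        by_contra! h
        simp only [Matrix.mul_apply, Matrix.transpose_apply] at hW
        rw [Finset.sum_eq_single i (fun k _ hk => h k hk) (by simp)] at hW
        exact mul_ne_zero hne (hd i).ne' hW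
      have hik : i < k := lt_of_le_of_ne
        (not_lt.1 fun h => right_ne_zero_of_mul hk (hV i k h)) hki.symm
      refine exists_walk_glue (R := fun a b => a ≠ b ∧ (V * Vᵀ) a b ≠ 0) ?_ hik
        (ih k hik j (hji.trans hik) (left_ne_zero_of_mul hk))
        (ih k hik i hik (right_ne_zero_of_mul hk))
      rintro a b ⟨hab, h⟩
      refine ⟨hab.symm, ?_⟩
      rwa [← (Matrix.isSymm_mul_transpose_self V).apply]
    · refine ⟨1, fun t => if t = 0 then j else i, by simp, by simp, ?_, fun t h0 h1 => by omega⟩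
      intro t ht
      obtain rfl : t = 0 := by omega
      simpa using ⟨hji.ne, hW⟩

/-- Fill-in of the reverse Cholesky factor (Proposition 3, part 3, matrix form).
`V` ranges over all matrices satisfying the defining property of `rchol W`
(upper triangular with strictly positive diagonal and `V * Vᵀ = W`). A walk in the
graph `G` (with an edge between `a ≠ b` iff `W a b ≠ 0`) is encoded as a finite
sequence `p 0, …, p m` of vertices with consecutive vertices adjacent; its
intermediate vertices are `p t` for `0 < t < m`. -/
theorem stmt_7 (n : ℕ) (W : Matrix (Fin n) (Fin n) ℝ) (hW : W.PosDef)
    (j i : Fin n) (hji : j < i)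
    (hwalk : ¬ ∃ (m : ℕ) (p : ℕ → Fin n), p 0 = j ∧ p m = i ∧
      (∀ t, t < m → (p t ≠ p (t + 1) ∧ W (p t) (p (t + 1)) ≠ 0)) ∧
      (∀ t, 0 < t → t < m → i < p t)) :
    ∀ V : Matrix (Fin n) (Fin n) ℝ,
      (∀ a b : Fin n, b < a → V a b = 0) → (∀ a : Fin n, 0 < V a a) → V * Vᵀ = W →
      V j i = 0 := by
  rintro V hV hd rfl
  by_contra h
  exact hwalk (exists_walk_of_upperTriangular_ne_zero hV hd i j hji h)
end

section
/- Monotonicity of conditional variance under enlarged conditioning (Schur complement form): Let Σ be an n×n real symmetric positive definite matrix, let i ∈ {1,…,n}, and let A ⊆ B ⊆ {1,…,n}\{i}. Then Σ_{i,i} − Σ_{i,B}·(Σ_{B,B})⁻¹·Σ_{B,i} ≤ Σ_{i,i} − Σ_{i,A}·(Σ_{A,A})⁻¹·Σ_{A,i}, where both quantities are strictly positive (with the convention that the subtracted term is 0 when the conditioning set is empty). -/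
open Matrix

/-- The residual vector of the best linear prediction of coordinate `i` from the coordinates in
`s`: it is supported on `insert i s`, is `1` at `i`, is `S`-orthogonal to the coordinates in `s`,
and its image under `S` has the Schur complement as its `i`-th entry. -/
lemma Matrix.PosDef.exists_schur_residual {m : Type*} [Fintype m] [DecidableEq m]
    {S : Matrix m m ℝ} (hS : S.PosDef) {i : m} {s : Finset m} (hi : i ∉ s) :
    ∃ w : m → ℝ, w i = 1 ∧ (∀ j, j ≠ i → j ∉ s → w j = 0) ∧ (∀ j ∈ s, (S *ᵥ w) j = 0) ∧
      (S *ᵥ w) i = S i i - ∑ a ∈ s.attach, ∑ b ∈ s.attach,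
        S i a.1 *
          ((S.submatrix (fun t : {x // x ∈ s} => t.1) (fun t : {x // x ∈ s} => t.1))⁻¹ a b) *
          S b.1 i := by
  set M := S.submatrix (fun t : {x // x ∈ s} => t.1) (fun t : {x // x ∈ s} => t.1) with hM
  have hMdet : IsUnit M.det :=
    (M.isUnit_iff_isUnit_det).1 (hS.submatrix Subtype.val_injective).isUnit
  let c : {x // x ∈ s} → ℝ := fun b => S b.1 i
  let y := M⁻¹ *ᵥ c
  let x : m → ℝ := fun j => if h : j ∈ s then y ⟨j, h⟩ else 0
  have hSx (j : m) : (S *ᵥ x) j = ∑ a : {x // x ∈ s}, S j a.1 * y a := by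
    have h : (S *ᵥ x) j = ∑ a ∈ s, S j a * x a :=
      (Finset.sum_subset s.subset_univ fun a _ ha => by simp [x, ha]).symm
    rw [h, ← Finset.sum_coe_sort]
    exact Finset.sum_congr rfl fun a _ => by simp [x]
  have hSw (j : m) : (S *ᵥ (Pi.single i 1 - x)) j = S j i - (S *ᵥ x) j := by
    simp [mulVec_sub]
  refine ⟨Pi.single i 1 - x, by simp [x, hi], fun j hji hj => by simp [x, hji, hj],
    fun j hj => ?_, ?_⟩
  · have h : M *ᵥ y = c := by
      simp [y, mulVec_mulVec, mul_nonsing_inv _ hMdet]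
    have h' : (S *ᵥ x) j = S j i := (hSx j).trans (congrFun h ⟨j, hj⟩)
    rw [hSw, h', sub_self]
  · rw [hSw, hSx]
    simp only [y, c, mulVec, dotProduct, Finset.mul_sum, mul_assoc, Finset.univ_eq_attach]

/-- Pairing a vector supported on `insert i s`, with entry `1` at `i`, against a vector vanishing
on `s` gives the `i`-th entry of the latter. -/
lemma dotProduct_eq_apply_of_support {m : Type*} [Fintype m] {u v : m → ℝ} {i : m}
    {s : Finset m} (hi : u i = 1) (hu : ∀ j, j ≠ i → j ∉ s → u j = 0) (hv : ∀ j ∈ s, v j = 0) :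
    u ⬝ᵥ v = v i := by
  rw [dotProduct, Finset.sum_eq_single i _ (by simp), hi, one_mul]
  intro j _ hj
  by_cases hjs : j ∈ s
  · rw [hv j hjs, mul_zero]
  · rw [hu j hj hjs, zero_mul]

/-- Monotonicity of conditional variance under enlarged conditioning (Schur complement
form). For a conditioning set `s`, the subtracted quadratic form is
`Σ_{i,s} (Σ_{s,s})⁻¹ Σ_{s,i}` (which is `0` when `s = ∅`, since the sum is empty). -/
theorem stmt_8 (n : ℕ) (S : Matrix (Fin n) (Fin n) ℝ) (hS : S.PosDef)
    (i : Fin n) (A B : Finset (Fin n)) (hAB : A ⊆ B) (hiB : i ∉ B) :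
    let q : Finset (Fin n) → ℝ := fun s =>
      ∑ a ∈ s.attach, ∑ b ∈ s.attach,
        S i a.1 *
          ((S.submatrix (fun t : {x // x ∈ s} => t.1) (fun t : {x // x ∈ s} => t.1))⁻¹ a b) *
          S b.1 i
    0 < S i i - q B ∧ 0 < S i i - q A ∧ S i i - q B ≤ S i i - q A := by
  intro q
  obtain ⟨u, hui, hu, hSu, hqA⟩ := hS.exists_schur_residual fun h => hiB (hAB h)
  obtain ⟨v, hvi, hv, hSv, hqB⟩ := hS.exists_schur_residual hiB
  rw [← hqA, ← hqB]
  have huu : u ⬝ᵥ S *ᵥ u = (S *ᵥ u) i := dotProduct_eq_apply_of_support hui hu hSu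
  have hvv : v ⬝ᵥ S *ᵥ v = (S *ᵥ v) i := dotProduct_eq_apply_of_support hvi hv hSv
  have huv : u ⬝ᵥ S *ᵥ v = (S *ᵥ v) i :=
    dotProduct_eq_apply_of_support hui (fun j hji hj => hu j hji fun h => hj (hAB h)) hSv
  have hST : Sᵀ = S := by simpa using hS.isHermitian.eq
  have hvu : v ⬝ᵥ S *ᵥ u = u ⬝ᵥ S *ᵥ v := by
    rw [dotProduct_mulVec, ← mulVec_transpose, hST, dotProduct_comm]
  have pos {w : Fin n → ℝ} (hw : w i = 1) : 0 < w ⬝ᵥ S *ᵥ w := by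
    simpa using hS.dotProduct_mulVec_pos (x := w) fun h => by simp [h] at hw
  refine ⟨hvv ▸ pos hvi, huu ▸ pos hui, ?_⟩
  have h : 0 ≤ (u - v) ⬝ᵥ S *ᵥ (u - v) := by
    simpa using hS.posSemidef.dotProduct_mulVec_nonneg (u - v)
  simp only [mulVec_sub, dotProduct_sub, sub_dotProduct] at h
  linarith
end

section
/- Kullback–Leibler monotonicity of Gaussian Vecchia approximations under enlarged conditioning sets: Let Σ be an n×n real symmetric positive definite matrix and let g, g' assign to each i ∈ {1,…,n} sets g(i) ⊆ g'(i) ⊆ {1,…,i−1}. Let μ_g be the probability measure on ℝⁿ with density f̂_g(x) = ∏_{i=1}^{n} f(x_i | x_{g(i)}), where f(x_i | x_A) is the exact conditional Gaussian density of coordinate i given the coordinates in A under N(0,Σ), and define μ_{g'} analogously. Then KL(N(0,Σ) ‖ μ_{g'}) ≤ KL(N(0,Σ) ‖ μ_g). -/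
open Matrix Real MeasureTheory

/-- Conditional mean `Σ_{i,A} (Σ_{A,A})⁻¹ x_A` of coordinate `i` given the coordinates
in `A` under the centered Gaussian with covariance `C`. -/
noncomputable def cMean {ι : Type} [Fintype ι] [DecidableEq ι]
    (C : Matrix ι ι ℝ) (A : Finset ι) (i : ι) (x : ι → ℝ) : ℝ :=
  ∑ a ∈ A.attach, ∑ b ∈ A.attach,
    C i a.1 *
      ((C.submatrix (fun t : {u // u ∈ A} => t.1) (fun t : {u // u ∈ A} => t.1))⁻¹ a b) * x b.1

/-- Conditional variance `Σ_{i,i} − Σ_{i,A} (Σ_{A,A})⁻¹ Σ_{A,i}`. -/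
noncomputable def cVar {ι : Type} [Fintype ι] [DecidableEq ι]
    (C : Matrix ι ι ℝ) (A : Finset ι) (i : ι) : ℝ :=
  C i i - ∑ a ∈ A.attach, ∑ b ∈ A.attach,
    C i a.1 *
      ((C.submatrix (fun t : {u // u ∈ A} => t.1) (fun t : {u // u ∈ A} => t.1))⁻¹ a b) * C b.1 i

/-- The exact conditional Gaussian density of coordinate `i` given the coordinates
in `A`, evaluated at `x`. -/
noncomputable def cDens {ι : Type} [Fintype ι] [DecidableEq ι]
    (C : Matrix ι ι ℝ) (A : Finset ι) (i : ι) (x : ι → ℝ) : ℝ :=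
  (2 * π * cVar C A i) ^ (-(1/2) : ℝ) *
    Real.exp (-(x i - cMean C A i x) ^ 2 / (2 * cVar C A i))

section StandardGaussian

open ProbabilityTheory

lemma integrable_gaussianPDFReal_mul {h : ℝ → ℝ} (hh : Integrable h (gaussianReal 0 1)) :
    Integrable (fun y => gaussianPDFReal 0 1 y * h y) := by
  rw [gaussianReal_of_var_ne_zero 0 one_ne_zero] at hh
  have := (integrable_withDensity_iff_integrable_smul₀' (by fun_prop)
    (by simp [gaussianPDF])).1 hh
  simpa [toReal_gaussianPDF] using this

lemma integral_gaussianPDFReal_mul (h : ℝ → ℝ) :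
    ∫ y, gaussianPDFReal 0 1 y * h y = ∫ y, h y ∂gaussianReal 0 1 := by
  rw [integral_gaussianReal_eq_integral_smul one_ne_zero]
  simp

lemma integral_sq_gaussianReal_zero_one : ∫ y, y ^ 2 ∂gaussianReal 0 1 = 1 := by
  have h := variance_fun_id_gaussianReal (μ := 0) (v := 1)
  rw [variance_eq_integral (by fun_prop), integral_id_gaussianReal] at h
  simpa using h

lemma mul_dotProduct_mulVec_eq_sum {ι : Type*} [Fintype ι]
    (c : ℝ) (M : Matrix ι ι ℝ) (x : ι → ℝ) :
    c * (x ⬝ᵥ (M *ᵥ x)) = ∑ i, ∑ j, M i j * (c * (x i * x j)) := by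
  simp only [dotProduct, mulVec, Finset.mul_sum]
  exact Finset.sum_congr rfl fun i _ => Finset.sum_congr rfl fun j _ => by ring

variable {ι : Type*} [Fintype ι] [DecidableEq ι]

lemma prod_gaussianPDFReal_mul_mul (i j : ι) (y : ι → ℝ) :
    (∏ k, gaussianPDFReal 0 1 (y k)) * (y i * y j) =
      ∏ k, gaussianPDFReal 0 1 (y k) *
        ((if k = i then y k else 1) * (if k = j then y k else 1)) := by
  rw [Finset.prod_mul_distrib, Finset.prod_mul_distrib]
  simp

lemma integrable_prod_gaussianPDFReal_mul_mul (i j : ι) :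
    Integrable fun y : ι → ℝ => (∏ k, gaussianPDFReal 0 1 (y k)) * (y i * y j) := by
  simp_rw [prod_gaussianPDFReal_mul_mul]
  refine Integrable.fintype_prod (μ := fun _ => volume) (f := fun k t => gaussianPDFReal 0 1 t *
    ((if k = i then t else 1) * (if k = j then t else 1))) fun k => ?_
  refine integrable_gaussianPDFReal_mul ?_
  have h1 : Integrable (fun t : ℝ => t) (gaussianReal 0 1) :=
    (memLp_id_gaussianReal' 1 (by simp)).integrable le_rfl
  have h2 : Integrable (fun t : ℝ => t * t) (gaussianReal 0 1) := by
    simpa [pow_two] using (memLp_id_gaussianReal' (μ := 0) (v := 1) 2 (by simp)).integrable_sq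
  split_ifs
  · exact h2
  · simpa using h1
  · simpa using h1
  · simp

lemma integral_prod_gaussianPDFReal_mul_mul (i j : ι) :
    ∫ y : ι → ℝ, (∏ k, gaussianPDFReal 0 1 (y k)) * (y i * y j) = if i = j then 1 else 0 := by
  simp_rw [prod_gaussianPDFReal_mul_mul]
  rw [integral_fintype_prod_volume_eq_prod (f := fun k t => gaussianPDFReal 0 1 t *
    ((if k = i then t else 1) * (if k = j then t else 1)))]
  simp_rw [integral_gaussianPDFReal_mul]
  split_ifs with hij
  · subst hij
    refine Finset.prod_eq_one fun k _ => ?_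
    split_ifs
    · simpa [pow_two] using integral_sq_gaussianReal_zero_one
    · simp
  · refine Finset.prod_eq_zero (Finset.mem_univ i) ?_
    simp [hij]

lemma integrable_prod_gaussianPDFReal_mul_quadratic (M : Matrix ι ι ℝ) :
    Integrable fun y : ι → ℝ => (∏ k, gaussianPDFReal 0 1 (y k)) * (y ⬝ᵥ (M *ᵥ y)) := by
  simp_rw [mul_dotProduct_mulVec_eq_sum]
  exact integrable_finsetSum _ fun i _ => integrable_finsetSum _ fun j _ =>
    (integrable_prod_gaussianPDFReal_mul_mul i j).const_mul _

lemma integral_prod_gaussianPDFReal_mul_quadratic (M : Matrix ι ι ℝ) :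
    ∫ y : ι → ℝ, (∏ k, gaussianPDFReal 0 1 (y k)) * (y ⬝ᵥ (M *ᵥ y)) = M.trace := by
  simp_rw [mul_dotProduct_mulVec_eq_sum]
  have hint : ∀ i j, Integrable fun y : ι → ℝ =>
      M i j * ((∏ k, gaussianPDFReal 0 1 (y k)) * (y i * y j)) :=
    fun i j => (integrable_prod_gaussianPDFReal_mul_mul i j).const_mul _
  rw [integral_finsetSum _ fun i _ => integrable_finsetSum _ fun j _ => hint i j]
  simp_rw [fun i => integral_finsetSum Finset.univ fun j _ => hint i j, integral_const_mul,
    integral_prod_gaussianPDFReal_mul_mul]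
  simp [Matrix.trace]

end StandardGaussian

section GaussianDensity

open ProbabilityTheory

lemma sq_dotProduct_eq_quadratic {ι : Type*} [Fintype ι] (w x : ι → ℝ) :
    (w ⬝ᵥ x) ^ 2 = x ⬝ᵥ (vecMulVec w w *ᵥ x) := by
  rw [vecMulVec_mulVec, pow_two, dotProduct_comm x]
  simp

variable {ι : Type*} [Fintype ι] [DecidableEq ι] {S : Matrix ι ι ℝ}

/-- The Lebesgue density of the centered Gaussian measure with covariance `S`. -/
noncomputable def gaussianDensity (S : Matrix ι ι ℝ) (x : ι → ℝ) : ℝ :=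
  (2 * π) ^ (-(Fintype.card ι : ℝ) / 2) * S.det ^ (-(1/2) : ℝ) *
    Real.exp (-(1/2) * (x ⬝ᵥ (S⁻¹ *ᵥ x)))

lemma continuous_gaussianDensity : Continuous (gaussianDensity S) := by
  unfold gaussianDensity
  fun_prop

lemma Matrix.PosDef.exists_eq_mul_transpose (hS : S.PosDef) :
    ∃ B : Matrix ι ι ℝ, B.det ≠ 0 ∧ S = B * Bᵀ := by
  obtain ⟨B, hB, h⟩ := by
    open scoped MatrixOrder in
    exact CStarAlgebra.isStrictlyPositive_iff_eq_star_mul_self.mp hS.isStrictlyPositive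
  refine ⟨Bᵀ, ?_, by simpa [star_eq_conjTranspose] using h⟩
  rw [det_transpose]
  exact ((Matrix.isUnit_iff_isUnit_det B).1 hB).ne_zero

lemma gaussianDensity_mulVec {B : Matrix ι ι ℝ} (hB : B.det ≠ 0) (y : ι → ℝ) :
    |B.det| * gaussianDensity (B * Bᵀ) (B *ᵥ y) = ∏ k, gaussianPDFReal 0 1 (y k) := by
  have hu : IsUnit B.det := hB.isUnit
  have hq : (B *ᵥ y) ⬝ᵥ ((B * Bᵀ)⁻¹ *ᵥ (B *ᵥ y)) = ∑ k, y k ^ 2 := by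
    rw [Matrix.mul_inv_rev, mulVec_mulVec, Matrix.mul_assoc, nonsing_inv_mul _ hu, Matrix.mul_one,
      dotProduct_mulVec, ← mulVec_transpose, ← transpose_nonsing_inv, transpose_transpose,
      mulVec_mulVec, nonsing_inv_mul _ hu, one_mulVec]
    simp [dotProduct, pow_two]
  have hd : (B * Bᵀ).det ^ (-(1/2) : ℝ) = |B.det|⁻¹ := by
    rw [det_mul, det_transpose, ← abs_mul_abs_self, Real.rpow_neg (by positivity),
      ← Real.sqrt_eq_rpow, Real.sqrt_mul_self (abs_nonneg _)]
  have hc : (2 * π) ^ (-(Fintype.card ι : ℝ) / 2) = (√(2 * π))⁻¹ ^ Fintype.card ι := by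
    rw [Real.sqrt_eq_rpow, ← Real.rpow_neg (by positivity), ← Real.rpow_natCast,
      ← Real.rpow_mul (by positivity)]
    ring_nf
  rw [gaussianDensity, hq, hd, hc]
  simp only [gaussianPDFReal, Finset.prod_mul_distrib, ← Real.exp_sum]
  have : |B.det| ≠ 0 := abs_ne_zero.2 hB
  simp only [sub_zero, NNReal.coe_one, mul_one, Finset.prod_const, Finset.card_univ,
    ← Finset.sum_div, Finset.sum_neg_distrib]
  rw [show -(∑ k, y k ^ 2) / 2 = -(1/2) * ∑ k, y k ^ 2 by ring]
  field_simp

lemma integral_eq_abs_det_mul_integral_comp_mulVec {B : Matrix ι ι ℝ} (hB : B.det ≠ 0)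
    {h : (ι → ℝ) → ℝ} (hh : Continuous h) :
    ∫ x, h x = |B.det| * ∫ y, h (B *ᵥ y) := by
  have hm := Real.map_matrix_volume_pi_eq_smul_volume_pi hB
  have h1 : ∫ x, h x ∂(Measure.map (toLin' B) volume) = ∫ y, h (B *ᵥ y) :=
    integral_map (by fun_prop) hh.aestronglyMeasurable
  rw [hm, integral_smul_measure, ENNReal.toReal_ofReal (abs_nonneg _), abs_inv, smul_eq_mul] at h1
  rw [← h1, mul_inv_cancel_left₀ (abs_ne_zero.2 hB)]

lemma integrable_of_integrable_comp_mulVec {B : Matrix ι ι ℝ} (hB : B.det ≠ 0)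
    {h : (ι → ℝ) → ℝ} (hh : Continuous h) (hi : Integrable fun y => h (B *ᵥ y)) :
    Integrable h := by
  have hm := Real.map_matrix_volume_pi_eq_smul_volume_pi hB
  have h1 : Integrable h (Measure.map (toLin' B) volume) :=
    (integrable_map_measure hh.aestronglyMeasurable (by fun_prop)).2 hi
  rwa [hm, integrable_smul_measure (by simpa using hB) ENNReal.ofReal_ne_top] at h1

lemma gaussianDensity_mulVec_mul_quadratic {B : Matrix ι ι ℝ} (hB : B.det ≠ 0)
    (M : Matrix ι ι ℝ) (y : ι → ℝ) :
    gaussianDensity (B * Bᵀ) (B *ᵥ y) * ((B *ᵥ y) ⬝ᵥ (M *ᵥ (B *ᵥ y))) =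
      |B.det|⁻¹ * ((∏ k, gaussianPDFReal 0 1 (y k)) * (y ⬝ᵥ ((Bᵀ * M * B) *ᵥ y))) := by
  have h : (B *ᵥ y) ⬝ᵥ (M *ᵥ (B *ᵥ y)) = y ⬝ᵥ ((Bᵀ * M * B) *ᵥ y) := by
    rw [← mulVec_mulVec, ← mulVec_mulVec, dotProduct_mulVec y, vecMul_transpose]
  rw [h, ← gaussianDensity_mulVec hB]
  have : |B.det| ≠ 0 := abs_ne_zero.2 hB
  field_simp

lemma integrable_gaussianDensity (hS : S.PosDef) : Integrable (gaussianDensity S) := by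
  obtain ⟨B, hB, rfl⟩ := hS.exists_eq_mul_transpose
  refine integrable_of_integrable_comp_mulVec hB continuous_gaussianDensity ?_
  rw [← integrable_const_mul_iff (abs_ne_zero.2 hB).isUnit]
  simp_rw [gaussianDensity_mulVec hB]
  exact Integrable.fintype_prod fun _ => integrable_gaussianPDFReal 0 1

lemma integral_gaussianDensity (hS : S.PosDef) : ∫ x, gaussianDensity S x = 1 := by
  obtain ⟨B, hB, rfl⟩ := hS.exists_eq_mul_transpose
  rw [integral_eq_abs_det_mul_integral_comp_mulVec hB continuous_gaussianDensity,
    ← integral_const_mul]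
  simp_rw [gaussianDensity_mulVec hB]
  rw [integral_fintype_prod_volume_eq_pow, integral_gaussianPDFReal_eq_one 0 one_ne_zero, one_pow]

lemma integrable_gaussianDensity_mul_quadratic (hS : S.PosDef) (M : Matrix ι ι ℝ) :
    Integrable fun x => gaussianDensity S x * (x ⬝ᵥ (M *ᵥ x)) := by
  obtain ⟨B, hB, rfl⟩ := hS.exists_eq_mul_transpose
  refine integrable_of_integrable_comp_mulVec hB
    (continuous_gaussianDensity.mul (by fun_prop)) ?_
  simp_rw [gaussianDensity_mulVec_mul_quadratic hB]
  exact (integrable_prod_gaussianPDFReal_mul_quadratic _).const_mul _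

lemma integral_gaussianDensity_mul_quadratic (hS : S.PosDef) (M : Matrix ι ι ℝ) :
    ∫ x, gaussianDensity S x * (x ⬝ᵥ (M *ᵥ x)) = (M * S).trace := by
  obtain ⟨B, hB, rfl⟩ := hS.exists_eq_mul_transpose
  rw [integral_eq_abs_det_mul_integral_comp_mulVec hB
    (h := fun x => gaussianDensity (B * Bᵀ) x * (x ⬝ᵥ (M *ᵥ x)))
    (continuous_gaussianDensity.mul (by fun_prop))]
  simp_rw [gaussianDensity_mulVec_mul_quadratic hB]
  rw [integral_const_mul, mul_inv_cancel_left₀ (abs_ne_zero.2 hB),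
    integral_prod_gaussianPDFReal_mul_quadratic, Matrix.mul_assoc, trace_mul_comm,
    Matrix.mul_assoc]

lemma integrable_gaussianDensity_mul_sq (hS : S.PosDef) (w : ι → ℝ) :
    Integrable fun x => gaussianDensity S x * (w ⬝ᵥ x) ^ 2 := by
  simp_rw [sq_dotProduct_eq_quadratic]
  exact integrable_gaussianDensity_mul_quadratic hS _

lemma integral_gaussianDensity_mul_sq (hS : S.PosDef) (w : ι → ℝ) :
    ∫ x, gaussianDensity S x * (w ⬝ᵥ x) ^ 2 = w ⬝ᵥ (S *ᵥ w) := by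
  simp_rw [sq_dotProduct_eq_quadratic]
  rw [integral_gaussianDensity_mul_quadratic hS, vecMulVec_mul, trace_vecMulVec,
    dotProduct_mulVec, dotProduct_comm]

end GaussianDensity

section Vecchia

/-- The coefficients of the residual `x i - cMean S A i x` of the linear prediction of
coordinate `i` from the coordinates in `A`. -/
noncomputable def residualCoeff {ι : Type} [DecidableEq ι]
    (S : Matrix ι ι ℝ) (A : Finset ι) (i : ι) : ι → ℝ :=
  Pi.single i 1 - fun j => if h : j ∈ A then
    ∑ a : {u // u ∈ A},
      S i a.1 * (S.submatrix (fun t : {u // u ∈ A} => t.1) (fun t : {u // u ∈ A} => t.1))⁻¹ a ⟨j, h⟩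
    else 0

lemma residualCoeff_self {ι : Type} [DecidableEq ι] {S : Matrix ι ι ℝ}
    {A : Finset ι} {i : ι} (hi : i ∉ A) :
    residualCoeff S A i i = 1 := by
  simp [residualCoeff, hi]

variable {ι : Type} [Fintype ι] [DecidableEq ι] {S : Matrix ι ι ℝ}

lemma sum_attach_eq_sub_residualCoeff_dotProduct (A : Finset ι) (i : ι) (x : ι → ℝ) :
    ∑ a ∈ A.attach, ∑ b ∈ A.attach,
      S i a.1 * ((S.submatrix (fun t : {u // u ∈ A} => t.1)
        (fun t : {u // u ∈ A} => t.1))⁻¹ a b) * x b.1 =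
      x i - residualCoeff S A i ⬝ᵥ x := by
  rw [residualCoeff, sub_dotProduct, single_one_dotProduct, sub_sub_cancel, Finset.sum_comm]
  rw [dotProduct, ← Finset.sum_subset (Finset.subset_univ A) fun j _ hj => by simp [hj],
    ← Finset.sum_attach A]
  simp [Finset.sum_mul]

lemma sub_cMean_eq (A : Finset ι) (i : ι) (x : ι → ℝ) :
    x i - cMean S A i x = residualCoeff S A i ⬝ᵥ x := by
  rw [cMean, sum_attach_eq_sub_residualCoeff_dotProduct, sub_sub_cancel]

lemma mulVec_residualCoeff_apply (hS : S.PosDef) (A : Finset ι) (i b : ι) :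
    (S *ᵥ residualCoeff S A i) b = residualCoeff S A i ⬝ᵥ fun j => S j b := by
  rw [mulVec, dotProduct_comm]
  congr 1
  funext j
  simpa using hS.isHermitian.apply j b

lemma mulVec_residualCoeff_of_mem (hS : S.PosDef) {A : Finset ι} (i : ι) {b : ι} (hb : b ∈ A) :
    (S *ᵥ residualCoeff S A i) b = 0 := by
  have hT := hS.submatrix (e := fun t : {u // u ∈ A} => t.1) Subtype.val_injective
  have h := sum_attach_eq_sub_residualCoeff_dotProduct (S := S) A i fun j => S j b
  set T := S.submatrix (fun t : {u // u ∈ A} => t.1) (fun t : {u // u ∈ A} => t.1)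
  have hrow : ∀ a, ∑ c ∈ A.attach, S i a.1 * T⁻¹ a c * S c.1 b =
      S i a.1 * (1 : Matrix {u // u ∈ A} {u // u ∈ A} ℝ) a ⟨b, hb⟩ := fun a => by
    rw [← nonsing_inv_mul T ((isUnit_iff_isUnit_det T).1 hT.isUnit), Matrix.mul_apply,
      Finset.mul_sum]
    exact Finset.sum_congr rfl fun c _ => mul_assoc _ _ _
  rw [Finset.sum_congr rfl fun a _ => hrow a] at h
  simp only [Matrix.one_apply, mul_ite, mul_one, mul_zero, Finset.sum_ite_eq',
    Finset.mem_attach, if_true] at h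
  rw [mulVec_residualCoeff_apply hS]
  linarith

lemma cVar_eq (hS : S.PosDef) (A : Finset ι) (i : ι) :
    cVar S A i = residualCoeff S A i ⬝ᵥ (S *ᵥ residualCoeff S A i) := by
  have h : (Pi.single i 1 - residualCoeff S A i) ⬝ᵥ (S *ᵥ residualCoeff S A i) = 0 := by
    refine Finset.sum_eq_zero fun j _ => ?_
    by_cases hj : j ∈ A
    · rw [mulVec_residualCoeff_of_mem hS i hj, mul_zero]
    · simp [residualCoeff, hj]
  rw [sub_dotProduct, single_one_dotProduct, sub_eq_zero] at h
  rw [← h, mulVec_residualCoeff_apply hS, cVar,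
    sum_attach_eq_sub_residualCoeff_dotProduct A i fun j => S j i, sub_sub_cancel]

lemma cVar_pos (hS : S.PosDef) {A : Finset ι} {i : ι} (hi : i ∉ A) : 0 < cVar S A i := by
  rw [cVar_eq hS]
  refine hS.dotProduct_mulVec_pos fun h => ?_
  exact zero_ne_one ((congrFun h i).symm.trans (residualCoeff_self hi))

lemma cVar_anti (hS : S.PosDef) {A A' : Finset ι} (hA : A ⊆ A') (i : ι) :
    cVar S A' i ≤ cVar S A i := by
  set w := residualCoeff S A i with hw
  set w' := residualCoeff S A' i with hw'
  have hd : (w - w') ⬝ᵥ (S *ᵥ w') = 0 := by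
    refine Finset.sum_eq_zero fun j _ => ?_
    by_cases hj : j ∈ A'
    · rw [mulVec_residualCoeff_of_mem hS i hj, mul_zero]
    · have : j ∉ A := fun h => hj (hA h)
      simp [hw, hw', residualCoeff, hj, this]
  have hsymm : w' ⬝ᵥ (S *ᵥ (w - w')) = (w - w') ⬝ᵥ (S *ᵥ w') := by
    have : Sᵀ = S := by simpa using hS.isHermitian.eq
    rw [dotProduct_mulVec, ← mulVec_transpose, this, dotProduct_comm]
  have hnn : 0 ≤ (w - w') ⬝ᵥ (S *ᵥ (w - w')) := hS.posSemidef.dotProduct_mulVec_nonneg _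
  rw [cVar_eq hS, cVar_eq hS, ← hw, ← hw']
  have : w ⬝ᵥ (S *ᵥ w) = w' ⬝ᵥ (S *ᵥ w') + w' ⬝ᵥ (S *ᵥ (w - w')) + (w - w') ⬝ᵥ (S *ᵥ w')
      + (w - w') ⬝ᵥ (S *ᵥ (w - w')) := by
    simp only [mulVec_sub, sub_dotProduct, dotProduct_sub]
    ring
  linarith

lemma cDens_pos (hS : S.PosDef) {A : Finset ι} {i : ι} (hi : i ∉ A) (x : ι → ℝ) :
    0 < cDens S A i x := by
  have := cVar_pos hS hi
  unfold cDens
  positivity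

lemma log_cDens (hS : S.PosDef) {A : Finset ι} {i : ι} (hi : i ∉ A) (x : ι → ℝ) :
    Real.log (cDens S A i x) =
      -(1/2) * Real.log (2 * π * cVar S A i) -
        (2 * cVar S A i)⁻¹ * (residualCoeff S A i ⬝ᵥ x) ^ 2 := by
  have := cVar_pos hS hi
  rw [cDens, Real.log_mul (by positivity) (Real.exp_pos _).ne', Real.log_rpow (by positivity),
    Real.log_exp, sub_cMean_eq]
  field_simp
  ring

lemma integrable_gaussianDensity_mul_log_cDens (hS : S.PosDef) {A : Finset ι} {i : ι}
    (hi : i ∉ A) : Integrable fun x => gaussianDensity S x * Real.log (cDens S A i x) := by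
  simp_rw [log_cDens hS hi, mul_sub, mul_left_comm _ (2 * cVar S A i)⁻¹]
  exact ((integrable_gaussianDensity hS).mul_const _).sub
    ((integrable_gaussianDensity_mul_sq hS _).const_mul _)

lemma integral_gaussianDensity_mul_log_cDens (hS : S.PosDef) {A : Finset ι} {i : ι}
    (hi : i ∉ A) : ∫ x, gaussianDensity S x * Real.log (cDens S A i x) =
      -(1/2) * Real.log (2 * π * cVar S A i) - 1/2 := by
  have hv := cVar_pos hS hi
  simp_rw [log_cDens hS hi, mul_sub, mul_left_comm _ (2 * cVar S A i)⁻¹]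
  rw [integral_sub ((integrable_gaussianDensity hS).mul_const _)
    ((integrable_gaussianDensity_mul_sq hS _).const_mul _), integral_mul_const, integral_const_mul,
    integral_gaussianDensity hS, integral_gaussianDensity_mul_sq hS, ← cVar_eq hS]
  field_simp

lemma gaussianDensity_pos (hS : S.PosDef) (x : ι → ℝ) : 0 < gaussianDensity S x := by
  have := hS.det_pos
  unfold gaussianDensity
  positivity

lemma integrable_gaussianDensity_mul_log_self (hS : S.PosDef) :
    Integrable fun x => gaussianDensity S x * Real.log (gaussianDensity S x) := by
  have hd := hS.det_pos
  have h : ∀ x, Real.log (gaussianDensity S x) =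
      Real.log ((2 * π) ^ (-(Fintype.card ι : ℝ) / 2) * S.det ^ (-(1/2) : ℝ)) +
        -(1/2) * (x ⬝ᵥ (S⁻¹ *ᵥ x)) := fun x => by
    rw [gaussianDensity, Real.log_mul (by positivity) (Real.exp_pos _).ne', Real.log_exp]
  simp_rw [h, mul_add, mul_left_comm _ (-(1/2) : ℝ)]
  exact ((integrable_gaussianDensity hS).mul_const _).add
    ((integrable_gaussianDensity_mul_quadratic hS _).const_mul _)

lemma integral_gaussianDensity_mul_log_div_prod_cDens (hS : S.PosDef) {g : ι → Finset ι}
    (hg : ∀ i, i ∉ g i) :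
    ∫ x, gaussianDensity S x * Real.log (gaussianDensity S x / ∏ i, cDens S (g i) i x) =
      (∫ x, gaussianDensity S x * Real.log (gaussianDensity S x)) +
        ∑ i, ((1/2) * Real.log (2 * π * cVar S (g i) i) + 1/2) := by
  have h : ∀ x, gaussianDensity S x * Real.log (gaussianDensity S x / ∏ i, cDens S (g i) i x) =
      gaussianDensity S x * Real.log (gaussianDensity S x) -
        ∑ i, gaussianDensity S x * Real.log (cDens S (g i) i x) := fun x => by
    rw [Real.log_div (gaussianDensity_pos hS x).ne'
      (Finset.prod_pos fun i _ => cDens_pos hS (hg i) x).ne',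
      Real.log_prod fun i _ => (cDens_pos hS (hg i) x).ne', mul_sub, Finset.mul_sum]
  simp_rw [h]
  rw [integral_sub (integrable_gaussianDensity_mul_log_self hS)
    (integrable_finsetSum _ fun i _ => integrable_gaussianDensity_mul_log_cDens hS (hg i)),
    integral_finsetSum _ fun i _ => integrable_gaussianDensity_mul_log_cDens hS (hg i),
    sub_eq_add_neg, ← Finset.sum_neg_distrib]
  simp_rw [fun i => integral_gaussianDensity_mul_log_cDens hS (hg i)]
  congr 1
  exact Finset.sum_congr rfl fun i _ => by ring

end Vecchia

/-- Kullback–Leibler monotonicity of Gaussian Vecchia approximations under enlarged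
conditioning sets: here `KL(N(0,Σ) ‖ μ_g) = ∫ f(x) log (f(x) / f̂_g(x)) dx`, where `f`
is the exact `N(0,Σ)` density and `f̂_g(x) = ∏ i, f(x_i | x_{g(i)})`. -/
theorem stmt_9 (n : ℕ) (hn : 0 < n) (S : Matrix (Fin n) (Fin n) ℝ) (hS : S.PosDef)
    (g g' : Fin n → Finset (Fin n))
    (hsub : ∀ i : Fin n, g i ⊆ g' i) (hg' : ∀ i : Fin n, ∀ j ∈ g' i, j < i) :
    let f : (Fin n → ℝ) → ℝ := fun x =>
      (2 * π) ^ (-(n : ℝ) / 2) * S.det ^ (-(1/2) : ℝ) *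
        Real.exp (-(1/2) * (x ⬝ᵥ (S⁻¹ *ᵥ x)))
    (∫ x : Fin n → ℝ, f x * Real.log (f x / ∏ i : Fin n, cDens S (g' i) i x)) ≤
      ∫ x : Fin n → ℝ, f x * Real.log (f x / ∏ i : Fin n, cDens S (g i) i x) := by
  intro f
  have hf : f = gaussianDensity S := by
    funext x
    simp only [f, gaussianDensity, Fintype.card_fin]
  have hi' : ∀ i, i ∉ g' i := fun i h => lt_irrefl i (hg' i i h)
  have hi : ∀ i, i ∉ g i := fun i h => hi' i (hsub i h)
  rw [hf, integral_gaussianDensity_mul_log_div_prod_cDens hS hi',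
    integral_gaussianDensity_mul_log_div_prod_cDens hS hi]
  gcongr with i
  · have := cVar_pos hS (hi' i)
    positivity
  · exact cVar_anti hS (hsub i) i
end

section
/- Graph-theoretic core of Proposition 6 (disjoint descendants under the sparse general Vecchia condition): Let ℓ be a positive integer and let E be a binary relation ('is a parent of') on {1,…,ℓ} such that E(j,i) implies j < i. Assume the sparse general Vecchia condition: for all i and all j < k, if E(j,i) and E(k,i) both hold, then E(j,k) holds. Then for any j < i with ¬E(j,i), there is no walk from j to i in the undirected graph on {1,…,ℓ} whose edges are the pairs {a,b} with E(a,b) or E(b,a), all of whose intermediate vertices are strictly greater than i. -/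
/-- If any two parents of a common vertex are themselves related, then a walk between two distinct
vertices whose intermediate vertices all exceed both endpoints forces the endpoints to be
adjacent. -/
theorem adj_of_walk_through_larger {V : Type*} [LinearOrder V] {E : V → V → Prop}
    (hE : ∀ j i, E j i → j < i)
    (hSGV : ∀ i j k, j < k → E j i → E k i → E j k)
    (p : ℕ → V) (n a b : ℕ) (hn : b - a ≤ n) (hab : a ≤ b) (hne : p a ≠ p b)
    (hadj : ∀ t, a ≤ t → t < b → (E (p t) (p (t + 1)) ∨ E (p (t + 1)) (p t)))
    (hint : ∀ t, a < t → t < b → p a < p t ∧ p b < p t) :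
    E (p a) (p b) ∨ E (p b) (p a) := by
  induction n generalizing a b with
  | zero =>
    obtain rfl : a = b := by omega
    exact absurd rfl hne
  | succ n ih =>
    have hlt : a < b := lt_of_le_of_ne hab fun h => hne (h ▸ rfl)
    by_cases hb : b = a + 1
    · subst hb
      exact hadj a le_rfl hlt
    obtain ⟨c, hc, hmin⟩ := (Finset.Ioo a b).exists_min_image p
      ⟨a + 1, by rw [Finset.mem_Ioo]; omega⟩
    have hS : ((Finset.Ioo a b).filter fun t => p t = p c).Nonempty :=
      ⟨c, Finset.mem_filter.2 ⟨hc, rfl⟩⟩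
    obtain ⟨u, hu, hfirst⟩ := Finset.exists_min_image _ id hS
    obtain ⟨v, hv, hlast⟩ := Finset.exists_max_image _ id hS
    simp only [Finset.mem_filter, Finset.mem_Ioo, id, and_imp] at hu hv hmin hfirst hlast
    obtain ⟨⟨hau, hub⟩, hpu⟩ := hu
    obtain ⟨⟨hav, hvb⟩, hpv⟩ := hv
    have hac : p a < p c := hpu ▸ (hint u hau hub).1
    have hbc : p b < p c := hpu ▸ (hint u hau hub).2
    have h₁ : E (p a) (p c) := by
      have h := ih a u (by omega) hau.le (hpu ▸ hac.ne)
        (fun t h1 h2 => hadj t h1 (by omega)) fun t h1 h2 => by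
          refine ⟨(hint t h1 (by omega)).1, hpu ▸ lt_of_le_of_ne (hmin t h1 (by omega)) ?_⟩
          intro h
          have := hfirst t h1 (by omega) h.symm
          omega
      rw [hpu] at h
      exact h.resolve_right fun h => (hE _ _ h).not_gt hac
    have h₂ : E (p b) (p c) := by
      have h := ih v b (by omega) hvb.le (hpv ▸ hbc.ne')
        (fun t h1 h2 => hadj t (by omega) h2) fun t h1 h2 => by
          refine ⟨hpv ▸ lt_of_le_of_ne (hmin t (by omega) h2) ?_, (hint t (by omega) h2).2⟩
          intro h
          have := hlast t (by omega) h2 h.symm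
          omega
      rw [hpv] at h
      exact h.resolve_left fun h => (hE _ _ h).not_gt hbc
    exact (lt_or_gt_of_ne hne).imp (fun h => hSGV _ _ _ h h₁ h₂) fun h => hSGV _ _ _ h h₂ h₁

/-- Graph-theoretic core of Proposition 6 (disjoint descendants under the sparse
general Vecchia condition). A walk in the undirected graph whose edges are the pairs
`{a, b}` with `E a b` or `E b a` is encoded as a finite sequence `p 0, …, p m` with
consecutive vertices adjacent; its intermediate vertices are `p t` for `0 < t < m`. -/
theorem stmt_11 (ℓ : ℕ) (E : Fin ℓ → Fin ℓ → Prop)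
    (hE : ∀ j i : Fin ℓ, E j i → j < i)
    (hSGV : ∀ i j k : Fin ℓ, j < k → E j i → E k i → E j k) :
    ∀ j i : Fin ℓ, j < i → ¬ E j i →
      ¬ ∃ (m : ℕ) (p : ℕ → Fin ℓ), p 0 = j ∧ p m = i ∧
        (∀ t, t < m → (E (p t) (p (t + 1)) ∨ E (p (t + 1)) (p t))) ∧
        (∀ t, 0 < t → t < m → i < p t) := by
  rintro j i hji hnE ⟨m, p, rfl, rfl, hadj, hint⟩
  have h := adj_of_walk_through_larger hE hSGV p m 0 m (by omega) (Nat.zero_le m) hji.ne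
    (fun t _ ht => hadj t ht) fun t h0 hm => ⟨hji.trans (hint t h0 hm), hint t h0 hm⟩
  exact h.elim hnE fun h => (hE _ _ h).not_gt hji
end

section
/- Reverse Cholesky sparsity for sparse general Vecchia (matrix form of Proposition 6): Let q assign to each i ∈ {1,…,ℓ} a set q(i) ⊆ {1,…,i−1} satisfying the sparse general Vecchia condition: for all i and all j < k, if j ∈ q(i) and k ∈ q(i), then j ∈ q(k). Let W be an ℓ×ℓ real symmetric positive definite matrix such that W_{j,i} = 0 whenever j ≠ i, j ∉ q(i), i ∉ q(j), and there is no k with both i ∈ q(k) and j ∈ q(k). Then the reverse Cholesky factor V := rchol(W) satisfies V_{j,i} = 0 for all j < i with j ∉ q(i); consequently, if |q(i)| ≤ m for all i, then every column of V has at most m nonzero off-diagonal entries. -/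
open Matrix

/-- Reverse Cholesky sparsity for sparse general Vecchia (matrix form of
Proposition 6). `V` ranges over all matrices satisfying the defining property of
`rchol W` (upper triangular with strictly positive diagonal and `V * Vᵀ = W`). -/
theorem stmt_12 (ℓ : ℕ) (q : Fin ℓ → Finset (Fin ℓ))
    (hq : ∀ i : Fin ℓ, ∀ j ∈ q i, j < i)
    (hSGV : ∀ i : Fin ℓ, ∀ j ∈ q i, ∀ k ∈ q i, j < k → j ∈ q k)
    (W : Matrix (Fin ℓ) (Fin ℓ) ℝ) (hW : W.PosDef)
    (hsparse : ∀ j i : Fin ℓ, j ≠ i → j ∉ q i → i ∉ q j →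
      (¬ ∃ k : Fin ℓ, i ∈ q k ∧ j ∈ q k) → W j i = 0)
    (V : Matrix (Fin ℓ) (Fin ℓ) ℝ)
    (hVupper : ∀ a b : Fin ℓ, b < a → V a b = 0)
    (hVdiag : ∀ a : Fin ℓ, 0 < V a a)
    (hVfac : V * Vᵀ = W) :
    (∀ j i : Fin ℓ, j < i → j ∉ q i → V j i = 0) ∧
    (∀ m : ℕ, (∀ i : Fin ℓ, (q i).card ≤ m) →
      ∀ i : Fin ℓ, (Finset.univ.filter (fun j : Fin ℓ => j ≠ i ∧ V j i ≠ 0)).card ≤ m) := by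
  have key : ∀ i j : Fin ℓ, j < i → j ∉ q i → V j i = 0 := by
    intro i
    induction i using WellFoundedGT.induction with
    | ind i ih =>
      intro j hji hj
      have hWji : W j i = 0 := by
        refine hsparse j i hji.ne hj (fun h => (hq j i h).not_gt hji) ?_
        rintro ⟨k, hik, hjk⟩
        exact hj (hSGV k j hjk i hik hji)
      have hsum : (V * Vᵀ) j i = V j i * V i i := by
        rw [Matrix.mul_apply]
        refine Finset.sum_eq_single i (fun k _ hki => ?_) (by simp)
        rw [Matrix.transpose_apply]
        rcases lt_or_gt_of_ne hki with hlt | hgt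
        · rw [hVupper i k hlt, mul_zero]
        · by_cases hik : i ∈ q k
          · rw [ih k hgt j (hji.trans hgt) (fun hjk => hj (hSGV k j hjk i hik hji)), zero_mul]
          · rw [ih k hgt i hgt hik, mul_zero]
      rw [hVfac, hWji] at hsum
      exact (mul_eq_zero.mp hsum.symm).resolve_right (hVdiag i).ne'
  refine ⟨fun j i => key i j, fun m hm i => le_trans (Finset.card_le_card fun j hj => ?_) (hm i)⟩
  obtain ⟨hne, hV⟩ := (Finset.mem_filter.mp hj).2
  by_contra hjq
  rcases lt_or_gt_of_ne hne with hlt | hgt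
  · exact hV (key i j hlt hjq)
  · exact hV (hVupper j i hgt)
end

section
/- Standard Vecchia as a marginal of general Vecchia (identity derived in Section 3.1): In the latent-plus-noise Gaussian model, let q(i) ⊆ {1,…,i−1} for each i ∈ {1,…,ℓ}. Then for every z ∈ ℝ^ℓ, ∫_{ℝ^ℓ} ∏_{i=1}^{ℓ} [ (2πτ²)^{−1/2} exp(−(z_i − u_i)²/(2τ²)) ] · f(u_i | z_{q(i)}) du = ∏_{i=1}^{ℓ} f(z_i | z_{q(i)}), where f(u_i | z_{q(i)}) is the exact conditional Gaussian density of y_i at u_i given z_{q(i)}, and f(z_i | z_{q(i)}) is the exact conditional Gaussian density of z_i given z_{q(i)}, both under the joint Gaussian law of (y, z). -/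
open Matrix Real MeasureTheory

/-- The convolution of a centered Gaussian density of variance `b` with a Gaussian density of
mean `m` and variance `v`. -/
theorem integral_gaussian_mul_gaussian {b v : ℝ} (hb : 0 < b) (hv : 0 < v) (z m : ℝ) :
    ∫ u : ℝ, ((2 * π * b) ^ (-(1/2) : ℝ) * Real.exp (-(z - u) ^ 2 / (2 * b)) *
        ((2 * π * v) ^ (-(1/2) : ℝ) * Real.exp (-(u - m) ^ 2 / (2 * v)))) =
      (2 * π * (v + b)) ^ (-(1/2) : ℝ) * Real.exp (-(z - m) ^ 2 / (2 * (v + b))) := by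
  have hs : 0 < v + b := by positivity
  have hsplit : ∀ u : ℝ, (2 * π * b) ^ (-(1/2) : ℝ) * Real.exp (-(z - u) ^ 2 / (2 * b)) *
        ((2 * π * v) ^ (-(1/2) : ℝ) * Real.exp (-(u - m) ^ 2 / (2 * v))) =
      ((2 * π * b) ^ (-(1/2) : ℝ) * (2 * π * v) ^ (-(1/2) : ℝ) *
        Real.exp (-(z - m) ^ 2 / (2 * (v + b)))) *
        Real.exp (-((v + b) / (2 * v * b)) * (u - (v * z + b * m) / (v + b)) ^ 2) := by
    intro u
    rw [mul_mul_mul_comm, ← Real.exp_add, mul_assoc (_ * _) (Real.exp _), ← Real.exp_add]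
    congr 2
    field_simp
    ring
  have hconst : (2 * π * b) ^ (-(1/2) : ℝ) * (2 * π * v) ^ (-(1/2) : ℝ) *
      √(π / ((v + b) / (2 * v * b))) = (2 * π * (v + b)) ^ (-(1/2) : ℝ) := by
    rw [Real.sqrt_eq_rpow, ← Real.mul_rpow (by positivity) (by positivity),
      Real.rpow_neg (by positivity), Real.rpow_neg (by positivity),
      ← Real.inv_rpow (by positivity), ← Real.inv_rpow (by positivity),
      ← Real.mul_rpow (by positivity) (by positivity)]
    congr 1
    field_simp
  simp_rw [hsplit]
  rw [integral_const_mul,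
    integral_sub_right_eq_self
      (fun u : ℝ => Real.exp (-((v + b) / (2 * v * b)) * u ^ 2)) ((v * z + b * m) / (v + b)),
    integral_gaussian, mul_right_comm, hconst]

/-- Conditional variances under a positive definite covariance are positive. -/
theorem cVar_pos_s14 {ι : Type} [Fintype ι] [DecidableEq ι] {C : Matrix ι ι ℝ} (hC : C.PosDef)
    {A : Finset ι} {i : ι} (hi : i ∉ A) : 0 < cVar C A i := by
  let e : Unit ⊕ {u // u ∈ A} → ι := Sum.elim (fun _ => i) Subtype.val
  have he : Function.Injective e := by
    rintro (_ | a) (_ | b) h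
    · rfl
    · exact absurd ((show i = b.1 from h) ▸ b.2) hi
    · exact absurd ((show a.1 = i from h) ▸ a.2) hi
    · exact congrArg Sum.inr (Subtype.ext h)
  let S := C.submatrix (fun t : {u // u ∈ A} => t.1) (fun t : {u // u ∈ A} => t.1)
  have hS : S.PosDef := hC.submatrix Subtype.val_injective
  have hblock : C.submatrix e e =
      fromBlocks (of fun _ _ => C i i) (of fun _ a => C i a.1) (of fun a _ => C a.1 i) S := by
    ext (_ | a) (_ | b) <;> rfl
  have hdet := (hC.submatrix he).det_pos
  let _ := hS.isUnit.invertible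
  rw [hblock, det_fromBlocks₂₂] at hdet
  have hschur := pos_of_mul_pos_right hdet hS.det_pos.le
  rw [det_unique] at hschur
  refine hschur.trans_eq ?_
  simp only [cVar, Matrix.sub_apply, of_apply, mul_apply, invOf_eq_nonsing_inv, Finset.sum_mul,
    ← Finset.univ_eq_attach]
  exact congrArg _ Finset.sum_comm

/-- The covariance of a nondegenerate Gaussian vector together with its noisy version. -/
theorem posDef_fromBlocks_add_noise {n : Type*} [Fintype n] [DecidableEq n]
    {K : Matrix n n ℝ} (hK : K.PosDef) {s : ℝ} (hs : 0 < s) :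
    (fromBlocks K K K (K + s • 1)).PosDef := by
  refine .of_dotProduct_mulVec_pos ?_ fun x hx => ?_
  · exact hK.isHermitian.fromBlocks hK.isHermitian
      (hK.isHermitian.add (PosDef.one.smul hs).isHermitian)
  obtain ⟨a, b, rfl⟩ : ∃ a b, x = Sum.elim a b := ⟨_, _, (Sum.elim_comp_inl_inr x).symm⟩
  have hquad : star (Sum.elim a b) ⬝ᵥ (fromBlocks K K K (K + s • 1) *ᵥ Sum.elim a b) =
      star (a + b) ⬝ᵥ (K *ᵥ (a + b)) + s * (star b ⬝ᵥ b) := by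
    simp [fromBlocks_mulVec, add_mulVec, mulVec_add, smul_mulVec, star_trivial]
    ring
  rw [hquad]
  by_cases hab : a + b = 0
  · have hb : b ≠ 0 := by
      rintro rfl
      obtain rfl : a = 0 := by simpa using hab
      exact hx (by ext (_ | _) <;> rfl)
    have := dotProduct_star_self_pos_iff.mpr hb
    rw [hab]
    simp only [star_trivial] at this ⊢
    simpa using mul_pos hs this
  · have := hK.dotProduct_mulVec_pos hab
    have hb : 0 ≤ star b ⬝ᵥ b := dotProduct_star_self_nonneg b |>.trans_eq (by simp)
    positivity

/-- Standard Vecchia as a marginal of general Vecchia (identity derived in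
Section 3.1). The joint Gaussian law of `(y, z)` is centered with covariance `C` on
`Fin ℓ ⊕ Fin ℓ`, where `Sum.inl i` indexes `y_i` and `Sum.inr i` indexes `z_i`. -/
theorem stmt_14 (ℓ : ℕ) (hℓ : 0 < ℓ) (K : Matrix (Fin ℓ) (Fin ℓ) ℝ) (hK : K.PosDef)
    (τ : ℝ) (hτ : 0 < τ)
    (C : Matrix (Fin ℓ ⊕ Fin ℓ) (Fin ℓ ⊕ Fin ℓ) ℝ)
    (hC₁ : ∀ i j : Fin ℓ, C (Sum.inl i) (Sum.inl j) = K i j)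
    (hC₂ : ∀ i j : Fin ℓ, C (Sum.inl i) (Sum.inr j) = K i j)
    (hC₃ : ∀ i j : Fin ℓ, C (Sum.inr i) (Sum.inl j) = K i j)
    (hC₄ : ∀ i j : Fin ℓ, C (Sum.inr i) (Sum.inr j) = K i j + if i = j then τ ^ 2 else 0)
    (q : Fin ℓ → Finset (Fin ℓ)) (hq : ∀ i : Fin ℓ, ∀ j ∈ q i, j < i) :
    ∀ z : Fin ℓ → ℝ,
      (∫ u : Fin ℓ → ℝ,
          ∏ i : Fin ℓ,
            ((2 * π * τ ^ 2) ^ (-(1/2) : ℝ) * Real.exp (-(z i - u i) ^ 2 / (2 * τ ^ 2)) *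
              cDens C ((q i).image Sum.inr) (Sum.inl i) (Sum.elim u z))) =
        ∏ i : Fin ℓ, cDens C ((q i).image Sum.inr) (Sum.inr i) (Sum.elim 0 z) := by
  intro z
  have hCpos : C.PosDef := by
    convert posDef_fromBlocks_add_noise hK (pow_pos hτ 2)
    ext (i | i) (j | j)
    · exact hC₁ i j
    · exact hC₂ i j
    · exact hC₃ i j
    · simp [hC₄, one_apply]
  have hmem : ∀ i, Sum.inl i ∉ (q i).image (Sum.inr : Fin ℓ → Fin ℓ ⊕ Fin ℓ) := by simp
  have hrow : ∀ i, ∀ a ∈ (q i).image Sum.inr, C (Sum.inr i) a = C (Sum.inl i) a := by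
    intro i a ha
    obtain ⟨j, hj, rfl⟩ := Finset.mem_image.mp ha
    simp [hC₂, hC₄, (hq i j hj).ne']
  have hcol : ∀ i, ∀ a ∈ (q i).image Sum.inr, C a (Sum.inr i) = C a (Sum.inl i) := by
    intro i a ha
    obtain ⟨j, hj, rfl⟩ := Finset.mem_image.mp ha
    simp [hC₃, hC₄, (hq i j hj).ne]
  have hvar : ∀ i, cVar C ((q i).image Sum.inr) (Sum.inr i) =
      cVar C ((q i).image Sum.inr) (Sum.inl i) + τ ^ 2 := by
    intro i
    simp only [cVar, hrow i _ (Subtype.prop _), hcol i _ (Subtype.prop _), hC₁, hC₄, if_true]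
    ring
  have hmean : ∀ i (u : Fin ℓ → ℝ),
      cMean C ((q i).image Sum.inr) (Sum.inl i) (Sum.elim u z) =
        cMean C ((q i).image Sum.inr) (Sum.inr i) (Sum.elim 0 z) := by
    intro i u
    simp only [cMean, hrow i _ (Subtype.prop _)]
    refine Finset.sum_congr rfl fun a _ => Finset.sum_congr rfl fun b _ => ?_
    obtain ⟨j, -, hj⟩ := Finset.mem_image.mp b.2
    rw [← hj, Sum.elim_inr, Sum.elim_inr]
  simp only [cDens, hmean, hvar, Sum.elim_inl, Sum.elim_inr]
  rw [integral_fintype_prod_volume_eq_prod fun (i : Fin ℓ) (t : ℝ) =>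
    (2 * π * τ ^ 2) ^ (-(1/2) : ℝ) * Real.exp (-(z i - t) ^ 2 / (2 * τ ^ 2)) *
      ((2 * π * cVar C ((q i).image Sum.inr) (Sum.inl i)) ^ (-(1/2) : ℝ) *
        Real.exp (-(t - cMean C ((q i).image Sum.inr) (Sum.inr i) (Sum.elim 0 z)) ^ 2 /
          (2 * cVar C ((q i).image Sum.inr) (Sum.inl i))))]
  exact Finset.prod_congr rfl fun i _ =>
    integral_gaussian_mul_gaussian (pow_pos hτ 2) (cVar_pos_s14 hCpos (hmem i)) _ _
end
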